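/- For every α ∈ (0,1), the map t ↦ N_α^{(α+1)/2}(X_t) = exp((α+1) · h_α(p(·,t))) is concave on (0, t_α); equivalently, ∂²/∂t² exp((α+1) h_α(p(·,t))) ≤ 0 for all t ∈ (0, t_α). -/

import Mathlib

open MeasureTheory Real Filter
open scoped Classical

/-- The density `p(x,t)` of `X + √t Z` along the heat flow. -/
noncomputable def heatP (f : ℝ → ℝ) (t x : ℝ) : ℝ :=
  ∫ y : ℝ, f y * ((Real.sqrt (2 * Real.pi * t))⁻¹ * Real.exp (-(x - y) ^ 2 / (2 * t)))

/-- `p_k(x,t) = ∂^k p / ∂x^k`. -/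
noncomputable def pk (f : ℝ → ℝ) (k : ℕ) (t x : ℝ) : ℝ :=
  iteratedDeriv k (heatP f t) x

/-- `p̄_i = p_i / p`. -/
noncomputable def pbar (f : ℝ → ℝ) (i : ℕ) (t x : ℝ) : ℝ :=
  pk f i t x / heatP f t x

/-- The Rényi entropy `h_α(p(·,t))`, with the Shannon entropy at `α = 1`. -/
noncomputable def renyiEnt (f : ℝ → ℝ) (α t : ℝ) : ℝ :=
  if α = 1 then -∫ x : ℝ, heatP f t x * Real.log (heatP f t x)
  else (1 - α)⁻¹ * Real.log (∫ x : ℝ, heatP f t x ^ α)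

/-- Finiteness `|h_α(p(·,t))| < ∞` of the Rényi entropy at time `t`. -/
def renyiFinite (f : ℝ → ℝ) (α t : ℝ) : Prop :=
  if α = 1 then Integrable (fun x : ℝ => heatP f t x * Real.log (heatP f t x))
  else Integrable (fun x : ℝ => heatP f t x ^ α) ∧ 0 < ∫ x : ℝ, heatP f t x ^ α

/-- `t < t_α` where `t_α = sup { s > 0 : |h_α(p(·,s))| < ∞ }`. -/
def ltTalpha (f : ℝ → ℝ) (α t : ℝ) : Prop :=
  ∃ s : ℝ, t < s ∧ 0 < s ∧ renyiFinite f α s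

/-- The tilted expectation `E_α[g] = (∫ g p^α) / (∫ p^α)`. -/
noncomputable def Ea (f : ℝ → ℝ) (α t : ℝ) (g : ℝ → ℝ) : ℝ :=
  (∫ x : ℝ, g x * heatP f t x ^ α) / (∫ x : ℝ, heatP f t x ^ α)


namespace RenyiAux

/-- The Gaussian kernel. -/
noncomputable def gk (t u : ℝ) : ℝ := (Real.sqrt (2 * Real.pi * t))⁻¹ * Real.exp (-u ^ 2 / (2 * t))

/-- The polynomial factor of the `k`-th spatial derivative of the Gaussian kernel (`k ≤ 3`). -/
noncomputable def Qk (k : ℕ) (t u : ℝ) : ℝ :=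
  match k with
  | 0 => 1
  | 1 => -(t⁻¹ * u)
  | 2 => t⁻¹ ^ 2 * u ^ 2 - t⁻¹
  | 3 => -(t⁻¹ ^ 3 * u ^ 3) + 3 * t⁻¹ ^ 2 * u
  | _ => 0

/-- The `k`-th spatial derivative of the Gaussian kernel (`k ≤ 3`). -/
noncomputable def Kk (k : ℕ) (t u : ℝ) : ℝ := Qk k t u * gk t u

lemma gk_pos {t : ℝ} (ht : 0 < t) (u : ℝ) : 0 < gk t u := by
  unfold gk; positivity

lemma Qk_bound {t₁ : ℝ} (h1 : 0 < t₁) : ∃ M : ℝ, 0 < M ∧ ∀ t, t₁ ≤ t → ∀ k u,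
    |Qk k t u| ≤ M * (1 + u ^ 4) := by
  have hm : 0 < t₁⁻¹ := inv_pos.2 h1
  set m := t₁⁻¹ with hmdef
  refine ⟨4 * (1 + m) ^ 3, by positivity, ?_⟩
  intro t ht k u
  have ht0 : 0 < t := lt_of_lt_of_le h1 ht
  have hr0 : 0 < t⁻¹ := inv_pos.2 ht0
  have hrm : t⁻¹ ≤ m := inv_anti₀ h1 ht
  have hu1 : |u| ≤ 1 + u ^ 4 := by
    rw [abs_le]; constructor <;> nlinarith [sq_nonneg (u^2 - 1), sq_nonneg (u - 1), sq_nonneg (u+1), sq_nonneg u]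
  have hu2 : u ^ 2 ≤ 1 + u ^ 4 := by nlinarith [sq_nonneg (u^2 - 1)]
  have hu3 : |u ^ 3| ≤ 1 + u ^ 4 := by
    rw [abs_le]; constructor <;> nlinarith [sq_nonneg (u^2 - 1), sq_nonneg (u^2 - u), sq_nonneg (u^2+u), sq_nonneg u]
  have hr1 : t⁻¹ ≤ (1 + m) ^ 3 := by nlinarith [pow_pos hm 2, pow_pos hm 3]
  have hr2 : t⁻¹ ^ 2 ≤ (1 + m) ^ 3 := by
    calc t⁻¹ ^ 2 ≤ (1 + m) ^ 2 := by gcongr; linarith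
      _ ≤ (1 + m) ^ 3 := pow_le_pow_right₀ (by linarith) (by norm_num)
  have hr3 : t⁻¹ ^ 3 ≤ (1 + m) ^ 3 := by gcongr; linarith
  have hone : (1:ℝ) ≤ (1 + m) ^ 3 := one_le_pow₀ (by linarith)
  set S := (1 + m) ^ 3
  set V := 1 + u ^ 4 with hV
  have hV1 : 1 ≤ V := by rw [hV]; nlinarith [sq_nonneg (u^2)]
  have hSV : 0 ≤ S * V := by positivity
  have hS1 : t⁻¹ * |u| ≤ S * V := by gcongr
  have hS2 : t⁻¹ ^ 2 * u ^ 2 ≤ S * V := by gcongr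
  have hS3 : t⁻¹ ^ 3 * |u ^ 3| ≤ S * V := by gcongr
  have hS4 : t⁻¹ ^ 2 * |u| ≤ S * V := by gcongr
  have hS5 : t⁻¹ * 1 ≤ S * V := by gcongr
  have hS6 : (1:ℝ) * 1 ≤ S * V := by gcongr
  match k with
  | 0 => simp only [Qk, abs_one]; linarith
  | 1 =>
    simp only [Qk, abs_neg, abs_mul, abs_of_pos hr0]; linarith
  | 2 =>
    simp only [Qk]
    have := sq_nonneg u
    have : 0 ≤ t⁻¹ ^ 2 * u ^ 2 := by positivity
    rw [abs_le]; constructor <;> linarith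
  | 3 =>
    simp only [Qk]
    refine (abs_add_le _ _).trans ?_
    rw [abs_neg, abs_mul, abs_mul, abs_mul, abs_of_pos (pow_pos hr0 3), abs_of_pos (pow_pos hr0 2),
      abs_of_pos (by norm_num : (0:ℝ) < 3)]
    linarith
  | (n+4) => simp only [Qk, abs_zero]; linarith

lemma quart_bound {η : ℝ} (hη : 0 < η) : ∃ C : ℝ, 0 < C ∧ ∀ u : ℝ,
    1 + u ^ 4 ≤ C * Real.exp (η * u ^ 2) := by
  refine ⟨1 + 2 / η ^ 2, by positivity, ?_⟩
  intro u
  have h := Real.quadratic_le_exp_of_nonneg (x := η * u ^ 2) (by positivity)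
  have h0 : 0 ≤ η * u ^ 2 := by positivity
  have h1 : 1 ≤ Real.exp (η * u ^ 2) := by nlinarith [sq_nonneg (η * u^2)]
  have h2 : u ^ 4 ≤ 2 / η ^ 2 * Real.exp (η * u ^ 2) := by
    rw [div_mul_eq_mul_div, le_div_iff₀ (by positivity)]
    nlinarith
  linarith

lemma Kk_bound_exp {t₁ η : ℝ} (h1 : 0 < t₁) (hη : 0 < η) : ∃ C : ℝ, 0 < C ∧
    ∀ t, t₁ ≤ t → ∀ k u, |Kk k t u| ≤ C * (Real.exp (η * u ^ 2) * gk t u) := by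
  obtain ⟨M, hM, hQ⟩ := Qk_bound h1
  obtain ⟨C, hC, hq⟩ := quart_bound hη
  refine ⟨M * C, by positivity, fun t ht k u => ?_⟩
  have hg := gk_pos (lt_of_lt_of_le h1 ht) u
  rw [Kk, abs_mul, abs_of_pos hg]
  calc _ ≤ (M * (C * Real.exp (η * u ^ 2))) * gk t u := by
        gcongr
        exact (hQ t ht k u).trans (by gcongr; exact hq u)
    _ = _ := by ring

lemma Kk_bound {t₁ t₂ : ℝ} (h1 : 0 < t₁) (h2 : 0 < t₂) : ∃ C : ℝ, 0 < C ∧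
    ∀ t, t₁ ≤ t → t ≤ t₂ → ∀ k u, |Kk k t u| ≤ C := by
  obtain ⟨C, hC, hK⟩ := Kk_bound_exp h1 (η := (2 * t₂)⁻¹) (by positivity)
  refine ⟨C * (Real.sqrt (2 * Real.pi * t₁))⁻¹, by positivity, fun t ht ht' k u => ?_⟩
  have ht0 : 0 < t := lt_of_lt_of_le h1 ht
  refine (hK t ht k u).trans ?_
  gcongr
  unfold gk
  have e1 : Real.exp ((2 * t₂)⁻¹ * u ^ 2) * Real.exp (-u ^ 2 / (2 * t)) ≤ 1 := by
    rw [← Real.exp_add, Real.exp_le_one_iff]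
    have : (2 * t₂)⁻¹ ≤ (2 * t)⁻¹ := by gcongr
    have := mul_le_mul_of_nonneg_right this (sq_nonneg u)
    have e : -u ^ 2 / (2 * t) = -((2 * t)⁻¹ * u ^ 2) := by ring
    rw [e]; linarith
  have e2 : (Real.sqrt (2 * Real.pi * t))⁻¹ ≤ (Real.sqrt (2 * Real.pi * t₁))⁻¹ := by gcongr
  calc _ = (Real.sqrt (2 * Real.pi * t))⁻¹ * (Real.exp ((2 * t₂)⁻¹ * u ^ 2) * Real.exp (-u ^ 2 / (2 * t))) := by ring
    _ ≤ (Real.sqrt (2 * Real.pi * t₁))⁻¹ * 1 := by gcongr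
    _ = _ := by ring

lemma gk_hasDerivAt_x {t : ℝ} (ht : 0 < t) (u : ℝ) :
    HasDerivAt (gk t) (-(t⁻¹ * u) * gk t u) u := by
  have h : HasDerivAt (fun u : ℝ => -u ^ 2 / (2 * t)) (-(t⁻¹ * u)) u := by
    have := ((hasDerivAt_pow 2 u).neg).div_const (2 * t)
    refine HasDerivAt.congr_deriv this ?_
    field_simp
    simp
  have := h.exp.const_mul ((Real.sqrt (2 * Real.pi * t))⁻¹)
  unfold gk
  refine HasDerivAt.congr_deriv this ?_
  ring

lemma gk_hasDerivAt_t {t : ℝ} (ht : 0 < t) (u : ℝ) :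
    HasDerivAt (fun t => gk t u) (1 / 2 * (t⁻¹ ^ 2 * u ^ 2 - t⁻¹) * gk t u) t := by
  have hpi := Real.pi_pos
  have h : HasDerivAt (fun t : ℝ => -u ^ 2 / (2 * t)) (t⁻¹ ^ 2 * u ^ 2 / 2) t := by
    have := (((hasDerivAt_id t).const_mul 2).inv (by simp; positivity)).const_mul (-u ^ 2)
    refine HasDerivAt.congr_deriv this ?_
    simp only [id]
    field_simp
  have hs : HasDerivAt (fun t : ℝ => (Real.sqrt (2 * Real.pi * t))⁻¹)
      (-(t⁻¹ / 2) * (Real.sqrt (2 * Real.pi * t))⁻¹) t := by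
    have h0 : 0 < 2 * Real.pi * t := by positivity
    have := (((hasDerivAt_id t).const_mul (2 * Real.pi)).sqrt (by simp; positivity)).inv
      (by simp; positivity)
    refine HasDerivAt.congr_deriv this ?_
    simp only [id, mul_one]
    have hsq : Real.sqrt (2 * Real.pi * t) ^ 2 = 2 * Real.pi * t := Real.sq_sqrt h0.le
    have hp : 0 < Real.sqrt (2 * Real.pi * t) := Real.sqrt_pos.2 h0
    rw [hsq]
    field_simp
  have := hs.mul h.exp
  unfold gk
  refine HasDerivAt.congr_deriv this ?_
  ring

lemma Kk_hasDerivAt_x {t : ℝ} (ht : 0 < t) (k : ℕ) (hk : k < 3) (u : ℝ) :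
    HasDerivAt (Kk k t) (Kk (k + 1) t u) u := by
  have hg := gk_hasDerivAt_x ht u
  have hQ : ∀ q', HasDerivAt (Qk k t) q' u →
      HasDerivAt (Kk k t) (q' * gk t u + Qk k t u * (-(t⁻¹ * u) * gk t u)) u :=
    fun q' h => h.mul hg
  interval_cases k
  · refine (hQ 0 (hasDerivAt_const _ _)).congr_deriv ?_
    simp [Kk, Qk]
  · have h : HasDerivAt (Qk 1 t) (-(t⁻¹ * 1)) u := ((hasDerivAt_id u).const_mul _).neg
    refine (hQ _ h).congr_deriv ?_
    simp only [Kk, Qk]; ring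
  · have h : HasDerivAt (Qk 2 t) (t⁻¹ ^ 2 * (2 * u)) u := by
      have := ((hasDerivAt_pow 2 u).const_mul (t⁻¹ ^ 2)).sub_const (t⁻¹)
      refine this.congr_deriv ?_; simp
    refine (hQ _ h).congr_deriv ?_
    simp only [Kk, Qk]; ring

lemma Kk_hasDerivAt_t {t : ℝ} (ht : 0 < t) (k : ℕ) (hk : k < 2) (u : ℝ) :
    HasDerivAt (fun t => Kk k t u) (1 / 2 * Kk (k + 2) t u) t := by
  have hg := gk_hasDerivAt_t ht u
  have hQ : ∀ q', HasDerivAt (fun t => Qk k t u) q' t →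
      HasDerivAt (fun t => Kk k t u)
        (q' * gk t u + Qk k t u * (1 / 2 * (t⁻¹ ^ 2 * u ^ 2 - t⁻¹) * gk t u)) t :=
    fun q' h => h.mul hg
  interval_cases k
  · refine (hQ 0 (hasDerivAt_const _ _)).congr_deriv ?_
    simp [Kk, Qk]; ring
  · have h : HasDerivAt (fun t => Qk 1 t u) (-(-(t ^ 2)⁻¹ * u)) t :=
      ((hasDerivAt_inv ht.ne').mul_const _).neg
    refine (hQ _ h).congr_deriv ?_
    simp only [Kk, Qk]; ring

lemma Kk_measurable (k : ℕ) (t : ℝ) : Measurable (Kk k t) := by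
  have hg : Measurable (gk t) := by unfold gk; fun_prop
  have hQ : Measurable (Qk k t) := by
    match k with
    | 0 => exact measurable_const
    | 1 => show Measurable fun u : ℝ => -(t⁻¹ * u); fun_prop
    | 2 => show Measurable fun u : ℝ => t⁻¹ ^ 2 * u ^ 2 - t⁻¹; fun_prop
    | 3 => show Measurable fun u : ℝ => -(t⁻¹ ^ 3 * u ^ 3) + 3 * t⁻¹ ^ 2 * u; fun_prop
    | (n+4) => exact measurable_const
  exact hQ.mul hg

/-- The `k`-th spatial derivative of the density. -/
noncomputable def PP (f : ℝ → ℝ) (k : ℕ) (t x : ℝ) : ℝ := ∫ y : ℝ, f y * Kk k t (x - y)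

lemma heatP_eq (f : ℝ → ℝ) (t x : ℝ) : heatP f t x = PP f 0 t x := by
  simp [heatP, PP, Kk, Qk, gk]

lemma fK_aesm {f : ℝ → ℝ} (hf : Integrable f) (k : ℕ) (t x : ℝ) :
    AEStronglyMeasurable (fun y => f y * Kk k t (x - y)) volume :=
  hf.aestronglyMeasurable.mul
    ((Kk_measurable k t).comp (measurable_const.sub measurable_id)).aestronglyMeasurable

lemma fK_int {f : ℝ → ℝ} (hf : Integrable f) {t : ℝ} (ht : 0 < t) (k : ℕ) (x : ℝ) :
    Integrable (fun y => f y * Kk k t (x - y)) := by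
  obtain ⟨C, hC, hK⟩ := Kk_bound ht ht
  refine (hf.norm.mul_const C).mono' (fK_aesm hf k t x) (Eventually.of_forall fun y => ?_)
  rw [norm_mul]
  gcongr
  exact hK t le_rfl le_rfl k _

lemma PP_hasDerivAt_x {f : ℝ → ℝ} (hf : Integrable f) {t : ℝ} (ht : 0 < t) (k : ℕ) (hk : k < 3)
    (x : ℝ) : HasDerivAt (PP f k t) (PP f (k + 1) t x) x := by
  obtain ⟨C, hC, hK⟩ := Kk_bound ht ht
  refine (hasDerivAt_integral_of_dominated_loc_of_deriv_le (s := Set.univ)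
    (bound := fun y => ‖f y‖ * C) (F' := fun x y => f y * Kk (k + 1) t (x - y)) univ_mem
    (Eventually.of_forall fun x => fK_aesm hf k t x) (fK_int hf ht k x) (fK_aesm hf (k + 1) t x)
    (Eventually.of_forall fun y z _ => ?_) (hf.norm.mul_const C)
    (Eventually.of_forall fun y z _ => ?_)).2
  · rw [norm_mul]
    gcongr
    exact hK t le_rfl le_rfl _ _
  · have := ((Kk_hasDerivAt_x ht k hk (z - y)).comp z ((hasDerivAt_id z).sub_const y)).const_mul (f y)
    refine HasDerivAt.congr_deriv this ?_
    simp

lemma PP_hasDerivAt_t {f : ℝ → ℝ} (hf : Integrable f) {t : ℝ} (ht : 0 < t) (k : ℕ) (hk : k < 2)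
    (x : ℝ) : HasDerivAt (fun t => PP f k t x) (1 / 2 * PP f (k + 2) t x) t := by
  obtain ⟨C, hC, hK⟩ := Kk_bound (t₁ := t / 2) (t₂ := 2 * t) (by positivity) (by positivity)
  have := (hasDerivAt_integral_of_dominated_loc_of_deriv_le (s := Set.Ioo (t / 2) (2 * t)) (x₀ := t)
    (μ := volume) (F := fun t y => f y * Kk k t (x - y))
    (bound := fun y => ‖f y‖ * C) (F' := fun t y => f y * (1 / 2 * Kk (k + 2) t (x - y)))
    (Ioo_mem_nhds (by linarith) (by linarith))
    (Eventually.of_forall fun t => fK_aesm hf k t x) (fK_int hf ht k x) ?_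
    (Eventually.of_forall fun y z hz => ?_) (hf.norm.mul_const C)
    (Eventually.of_forall fun y z hz => ?_)).2
  · refine HasDerivAt.congr_deriv this ?_
    unfold PP
    rw [← integral_const_mul]
    congr 1; ext y; ring
  · have := (fK_aesm hf (k + 2) t x).const_mul (1 / 2)
    refine this.congr (Eventually.of_forall fun y => ?_)
    simp only; ring
  · rw [norm_mul, norm_mul]
    gcongr
    have := hK z hz.1.le hz.2.le (k + 2) (x - y)
    rw [Real.norm_eq_abs, Real.norm_eq_abs, abs_of_pos (by norm_num : (0:ℝ) < 1 / 2)]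
    linarith [abs_nonneg (Kk (k + 2) z (x - y))]
  · have hz0 : 0 < z := by linarith [hz.1]
    exact (Kk_hasDerivAt_t hz0 k hk (x - y)).const_mul (f y)

lemma PP_pos {f : ℝ → ℝ} (hf : Integrable f) (hf0 : ∀ x, 0 ≤ f x) (hf1 : (∫ x, f x) = 1) {t : ℝ}
    (ht : 0 < t) (x : ℝ) : 0 < PP f 0 t x := by
  have hK : ∀ u, 0 < Kk 0 t u := fun u => by simpa [Kk, Qk] using gk_pos ht u
  unfold PP
  rw [integral_pos_iff_support_of_nonneg (fun y => mul_nonneg (hf0 y) (hK _).le) (fK_int hf ht 0 x)]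
  have h1 : 0 < ∫ x, f x := by rw [hf1]; exact one_pos
  rw [integral_pos_iff_support_of_nonneg hf0 hf] at h1
  convert h1 using 2
  ext y
  simp [(hK (x - y)).ne']

lemma gk_ratio {t s : ℝ} (ht : 0 < t) (hs : 0 < s) (u : ℝ) :
    gk t u * Real.exp (u ^ 2 / (2 * t) - u ^ 2 / (2 * s)) = Real.sqrt s / Real.sqrt t * gk s u := by
  unfold gk
  have e : Real.exp (-u ^ 2 / (2 * t)) * Real.exp (u ^ 2 / (2 * t) - u ^ 2 / (2 * s))
      = Real.exp (-u ^ 2 / (2 * s)) := by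
    rw [← Real.exp_add]; congr 1; ring
  rw [mul_assoc, e, Real.sqrt_mul (by positivity) t, Real.sqrt_mul (by positivity) s]
  have h1 : 0 < Real.sqrt t := Real.sqrt_pos.2 ht
  have h2 : 0 < Real.sqrt s := Real.sqrt_pos.2 hs
  field_simp

lemma dom {f : ℝ → ℝ} (hf : Integrable f) (hf0 : ∀ x, 0 ≤ f x) (hf1 : (∫ x, f x) = 1)
    {α t₁ t₂ s : ℝ} (hα : 0 < α) (hα1 : α < 1) (h1 : 0 < t₁) (h12 : t₁ ≤ t₂) (h2s : t₂ < s) :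
    ∃ C : ℝ, 0 < C ∧ ∀ t, t₁ ≤ t → t ≤ t₂ → ∀ x, ∃ E : ℝ, 1 ≤ E ∧
      (∀ k, |PP f k t x / PP f 0 t x| ≤ E) ∧ E ^ 4 * PP f 0 t x ^ α ≤ C * PP f 0 s x ^ α := by
  have h2 : 0 < t₂ := lt_of_lt_of_le h1 h12
  have hs : 0 < s := h2.trans h2s
  obtain ⟨δ, hδ⟩ : ∃ δ, δ = α / 4 := ⟨_, rfl⟩
  have hδ0 : 0 < δ := by rw [hδ]; positivity
  have hδ1 : δ < 1 := by rw [hδ]; linarith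
  obtain ⟨η, hη⟩ : ∃ η, η = δ * (1 / (2 * t₂) - 1 / (2 * s)) := ⟨_, rfl⟩
  have hη0 : 0 < η := by
    rw [hη]
    have : 1 / (2 * s) < 1 / (2 * t₂) := by
      apply one_div_lt_one_div_of_lt <;> linarith
    apply mul_pos hδ0; linarith
  obtain ⟨C, hC, hK⟩ := Kk_bound_exp h1 hη0
  obtain ⟨L, hL⟩ : ∃ L, L = Real.sqrt s / Real.sqrt t₁ := ⟨_, rfl⟩
  have hst1 : 0 < Real.sqrt t₁ := Real.sqrt_pos.2 h1
  have hL0 : 0 < L := by rw [hL]; have := Real.sqrt_pos.2 hs; positivity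
  obtain ⟨D, hD⟩ : ∃ D, D = 1 + C * (1 + L) := ⟨_, rfl⟩
  have hD1 : 1 ≤ D := by rw [hD]; have : 0 < C * (1 + L) := by positivity
                         linarith
  refine ⟨D ^ 4 * L ^ α, by positivity, fun t ht ht' x => ?_⟩
  have ht0 : 0 < t := lt_of_lt_of_le h1 ht
  have hp := PP_pos hf hf0 hf1 ht0 x
  have hq := PP_pos hf hf0 hf1 hs x
  set p := PP f 0 t x with hpdef
  set q := PP f 0 s x with hqdef
  -- ratio bound
  have hrat : ∀ u, gk t u * Real.exp (u ^ 2 / (2 * t) - u ^ 2 / (2 * s)) ≤ L * gk s u := by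
    intro u
    rw [gk_ratio ht0 hs, hL]
    have := (gk_pos hs u).le
    gcongr
  have hexp1 : ∀ u : ℝ, 1 ≤ Real.exp (u ^ 2 / (2 * t) - u ^ 2 / (2 * s)) := by
    intro u
    apply Real.one_le_exp
    have : u ^ 2 / (2 * s) ≤ u ^ 2 / (2 * t) := by
      have : t ≤ s := by linarith
      gcongr
    linarith
  have hgg : ∀ u, gk t u ≤ L * gk s u := fun u =>
    (le_mul_of_one_le_right (gk_pos ht0 u).le (hexp1 u)).trans (hrat u)
  have hK0 : ∀ r u, Kk 0 r u = gk r u := fun r u => by simp [Kk, Qk]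
  have hpq : p ≤ L * q := by
    rw [hpdef, hqdef]
    unfold PP
    rw [← integral_const_mul]
    refine integral_mono (fK_int hf ht0 0 x) ((fK_int hf hs 0 x).const_mul L) fun y => ?_
    simp only [hK0]
    calc _ ≤ f y * (L * gk s (x - y)) := by have := hf0 y; gcongr; exact hgg _
      _ = _ := by ring
  obtain ⟨R, hR⟩ : ∃ R, R = q / p := ⟨_, rfl⟩
  have hR0 : 0 < R := by rw [hR]; positivity
  have hLR : 1 ≤ L * R := by
    rw [hR, ← mul_div_assoc, le_div_iff₀ hp]; linarith
  -- kernel bound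
  have hker : ∀ k u, |Kk k t u| ≤ C * (R ^ δ * (gk t u + L * R⁻¹ * gk s u)) := by
    intro k u
    refine (hK t ht k u).trans ?_
    have hg := gk_pos ht0 u
    obtain ⟨z, hz⟩ : ∃ z, z = Real.exp (u ^ 2 / (2 * t) - u ^ 2 / (2 * s)) := ⟨_, rfl⟩
    have hz0 : 0 < z := by rw [hz]; exact Real.exp_pos _
    have e1 : Real.exp (η * u ^ 2) ≤ z ^ δ := by
      rw [hz, ← Real.exp_mul, Real.exp_le_exp, hη]
      have : u ^ 2 / (2 * t₂) ≤ u ^ 2 / (2 * t) := by gcongr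
      calc _ = (u ^ 2 / (2 * t₂) - u ^ 2 / (2 * s)) * δ := by ring
        _ ≤ _ := by gcongr
    have e2 : z ^ δ ≤ R ^ δ * (1 + R⁻¹ * z) := by
      have := Real.geom_mean_le_arith_mean2_weighted (w₁ := 1 - δ) (w₂ := δ) (p₁ := 1)
        (p₂ := R⁻¹ * z) (by linarith) hδ0.le zero_le_one (by positivity) (by ring)
      rw [Real.one_rpow, one_mul] at this
      have h3 : z ^ δ = R ^ δ * (R⁻¹ * z) ^ δ := by
        rw [← Real.mul_rpow hR0.le (by positivity)]
        congr 1; field_simp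
      rw [h3]
      gcongr
      have h4 : 0 < R⁻¹ * z := by positivity
      nlinarith
    have e3 := hrat u
    rw [← hz] at e3
    refine mul_le_mul_of_nonneg_left ?_ hC.le
    calc Real.exp (η * u ^ 2) * gk t u ≤ R ^ δ * (1 + R⁻¹ * z) * gk t u := by
          gcongr; exact e1.trans e2
      _ = R ^ δ * (gk t u + R⁻¹ * (gk t u * z)) := by ring
      _ ≤ R ^ δ * (gk t u + R⁻¹ * (L * gk s u)) := by gcongr
      _ = _ := by ring
  have hPk : ∀ k, |PP f k t x| ≤ C * (R ^ δ * ((1 + L) * p)) := by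
    intro k
    have hi : Integrable (fun y => C * R ^ δ * (f y * Kk 0 t (x - y))
        + C * R ^ δ * (L * R⁻¹) * (f y * Kk 0 s (x - y))) :=
      ((fK_int hf ht0 0 x).const_mul _).add ((fK_int hf hs 0 x).const_mul _)
    have := norm_integral_le_of_norm_le hi (f := fun y => f y * Kk k t (x - y))
      (Eventually.of_forall fun y => by
        rw [norm_mul, Real.norm_eq_abs, Real.norm_eq_abs, abs_of_nonneg (hf0 y)]
        simp only [hK0]
        calc _ ≤ f y * (C * (R ^ δ * (gk t (x - y) + L * R⁻¹ * gk s (x - y)))) := by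
              have := hf0 y
              gcongr
              exact hker k _
          _ = _ := by ring)
    refine this.trans (le_of_eq ?_)
    rw [integral_add ((fK_int hf ht0 0 x).const_mul _) ((fK_int hf hs 0 x).const_mul _),
      integral_const_mul, integral_const_mul]
    change C * R ^ δ * p + C * R ^ δ * (L * R⁻¹) * q = _
    have : R⁻¹ * q = p := by rw [hR]; field_simp
    calc _ = C * R ^ δ * p + C * R ^ δ * L * (R⁻¹ * q) := by ring
      _ = _ := by rw [this]; ring
  have hL' : 1 ≤ (L * R) ^ δ := Real.one_le_rpow hLR hδ0.le
  have hL1 : 1 ≤ L := by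
    rw [hL, le_div_iff₀ hst1, one_mul]
    exact Real.sqrt_le_sqrt (by linarith)
  refine ⟨D * (L * R) ^ δ, one_le_mul_of_one_le_of_one_le hD1 hL', ?_, ?_⟩
  · intro k
    rw [abs_div, abs_of_pos hp, div_le_iff₀ hp]
    refine (hPk k).trans ?_
    have h3 : R ^ δ ≤ (L * R) ^ δ :=
      Real.rpow_le_rpow hR0.le (le_mul_of_one_le_left hR0.le hL1) hδ0.le
    calc C * (R ^ δ * ((1 + L) * p)) ≤ C * ((L * R) ^ δ * ((1 + L) * p)) := by gcongr
      _ = (C * (1 + L)) * (L * R) ^ δ * p := by ring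
      _ ≤ D * (L * R) ^ δ * p := by gcongr; linarith
  · have h4 : ((L * R) ^ δ) ^ 4 = (L * R) ^ α := by
      rw [← Real.rpow_natCast, ← Real.rpow_mul (by positivity)]
      congr 1; rw [hδ]; push_cast; ring
    have h5 : R * p = q := by rw [hR]; field_simp
    refine le_of_eq ?_
    rw [mul_pow, h4, Real.mul_rpow hL0.le hR0.le, ← h5, Real.mul_rpow hR0.le hp.le]
    ring

/-- Weighted monomials `p^α a^i b^j c^l` in the normalized derivatives. -/
noncomputable def MM (f : ℝ → ℝ) (α : ℝ) (i j l : ℕ) (t x : ℝ) : ℝ :=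
  PP f 0 t x ^ α * ((PP f 1 t x / PP f 0 t x) ^ i * (PP f 2 t x / PP f 0 t x) ^ j *
    (PP f 3 t x / PP f 0 t x) ^ l)

lemma MM_bound {f : ℝ → ℝ} (hf : Integrable f) (hf0 : ∀ x, 0 ≤ f x) (hf1 : (∫ x, f x) = 1)
    {α t₁ t₂ s : ℝ} (hα : 0 < α) (hα1 : α < 1) (h1 : 0 < t₁) (h12 : t₁ ≤ t₂) (h2s : t₂ < s) :
    ∃ C : ℝ, 0 < C ∧ ∀ t, t₁ ≤ t → t ≤ t₂ → ∀ x, ∀ i j l : ℕ, i + j + l ≤ 4 →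
      |MM f α i j l t x| ≤ C * PP f 0 s x ^ α := by
  obtain ⟨C, hC, h⟩ := dom hf hf0 hf1 hα hα1 h1 h12 h2s
  refine ⟨C, hC, fun t ht ht' x i j l hijl => ?_⟩
  obtain ⟨E, hE, hk, hw⟩ := h t ht ht' x
  have ht0 : 0 < t := lt_of_lt_of_le h1 ht
  have hp := PP_pos hf hf0 hf1 ht0 x
  have hpa : 0 < PP f 0 t x ^ α := Real.rpow_pos_of_pos hp _
  refine le_trans ?_ hw
  rw [MM, abs_mul, abs_mul, abs_mul, abs_of_pos hpa, abs_pow, abs_pow, abs_pow, mul_comm]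
  gcongr
  calc _ ≤ E ^ i * E ^ j * E ^ l := by gcongr <;> exact hk _
    _ = E ^ (i + j + l) := by rw [pow_add, pow_add]
    _ ≤ E ^ 4 := pow_le_pow_right₀ hE hijl

lemma PP_meas {f : ℝ → ℝ} (hf : Integrable f) {t : ℝ} (ht : 0 < t) (k : ℕ) (hk : k ≤ 3) :
    Measurable (PP f k t) := by
  rcases Nat.eq_zero_or_pos k with rfl | hk0
  · have : Continuous (PP f 0 t) := continuous_iff_continuousAt.2 fun x =>
      (PP_hasDerivAt_x hf ht 0 (by norm_num) x).continuousAt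
    exact this.measurable
  · obtain ⟨m, rfl⟩ : ∃ m, k = m + 1 := ⟨k - 1, by omega⟩
    have : PP f (m + 1) t = deriv (PP f m t) := by
      ext x; exact (PP_hasDerivAt_x hf ht m (by omega) x).deriv.symm
    rw [this]; exact measurable_deriv _

lemma MM_meas {f : ℝ → ℝ} (hf : Integrable f) {t : ℝ} (ht : 0 < t) (α : ℝ) (i j l : ℕ) :
    Measurable (MM f α i j l t) := by
  have h0 := PP_meas hf ht 0 (by norm_num)
  have h1 := PP_meas hf ht 1 (by norm_num)
  have h2 := PP_meas hf ht 2 (by norm_num)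
  have h3 := PP_meas hf ht 3 (by norm_num)
  exact (h0.pow_const α).mul ((((h1.div h0).pow_const i).mul ((h2.div h0).pow_const j)).mul
    ((h3.div h0).pow_const l))

section
variable {f : ℝ → ℝ} {α t s : ℝ}

lemma MM_int (hf : Integrable f) (hf0 : ∀ x, 0 ≤ f x) (hf1 : (∫ x, f x) = 1)
    (hα : 0 < α) (hα1 : α < 1) (ht : 0 < t) (hts : t < s)
    (hI : Integrable (fun x => PP f 0 s x ^ α)) (i j l : ℕ) (h : i + j + l ≤ 4) :
    Integrable (MM f α i j l t) := by
  obtain ⟨C, hC, hb⟩ := MM_bound hf hf0 hf1 hα hα1 ht le_rfl hts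
  exact (hI.const_mul C).mono' (MM_meas hf ht α i j l).aestronglyMeasurable
    (Eventually.of_forall fun x => hb t le_rfl le_rfl x i j l h)

lemma w_x (hf : Integrable f) (hf0 : ∀ x, 0 ≤ f x) (hf1 : (∫ x, f x) = 1) (ht : 0 < t) (x : ℝ) :
    HasDerivAt (fun x => PP f 0 t x ^ α)
      (α * PP f 0 t x ^ α * (PP f 1 t x / PP f 0 t x)) x := by
  have hp := PP_pos hf hf0 hf1 ht x
  refine ((PP_hasDerivAt_x hf ht 0 (by norm_num) x).rpow_const (Or.inl hp.ne')).congr_deriv ?_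
  rw [Real.rpow_sub_one hp.ne']; ring

lemma w_t (hf : Integrable f) (hf0 : ∀ x, 0 ≤ f x) (hf1 : (∫ x, f x) = 1) (ht : 0 < t) (x : ℝ) :
    HasDerivAt (fun t => PP f 0 t x ^ α)
      (α / 2 * PP f 0 t x ^ α * (PP f 2 t x / PP f 0 t x)) t := by
  have hp := PP_pos hf hf0 hf1 ht x
  refine ((PP_hasDerivAt_t hf ht 0 (by norm_num) x).rpow_const (Or.inl hp.ne')).congr_deriv ?_
  rw [Real.rpow_sub_one hp.ne']; ring

lemma bar_x (hf : Integrable f) (hf0 : ∀ x, 0 ≤ f x) (hf1 : (∫ x, f x) = 1) (ht : 0 < t)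
    (k : ℕ) (hk : k < 3) (x : ℝ) :
    HasDerivAt (fun x => PP f k t x / PP f 0 t x)
      (PP f (k + 1) t x / PP f 0 t x
        - PP f k t x / PP f 0 t x * (PP f 1 t x / PP f 0 t x)) x := by
  have hp := PP_pos hf hf0 hf1 ht x
  refine ((PP_hasDerivAt_x hf ht k hk x).div (PP_hasDerivAt_x hf ht 0 (by norm_num) x)
    hp.ne').congr_deriv ?_
  field_simp

lemma bar_t (hf : Integrable f) (hf0 : ∀ x, 0 ≤ f x) (hf1 : (∫ x, f x) = 1) (ht : 0 < t)
    (x : ℝ) :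
    HasDerivAt (fun t => PP f 1 t x / PP f 0 t x)
      (1 / 2 * (PP f 3 t x / PP f 0 t x)
        - 1 / 2 * (PP f 1 t x / PP f 0 t x * (PP f 2 t x / PP f 0 t x))) t := by
  have hp := PP_pos hf hf0 hf1 ht x
  refine ((PP_hasDerivAt_t hf ht 1 (by norm_num) x).div (PP_hasDerivAt_t hf ht 0 (by norm_num) x)
    hp.ne').congr_deriv ?_
  simp only [Nat.reduceAdd]
  field_simp

/-- Integrals of the weighted monomials. -/
noncomputable def II (f : ℝ → ℝ) (α : ℝ) (i j l : ℕ) (t : ℝ) : ℝ := ∫ x, MM f α i j l t x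

lemma ibp1 (hf : Integrable f) (hf0 : ∀ x, 0 ≤ f x) (hf1 : (∫ x, f x) = 1)
    (hα : 0 < α) (hα1 : α < 1) (ht : 0 < t) (hts : t < s)
    (hI : Integrable (fun x => PP f 0 s x ^ α)) :
    II f α 0 1 0 t = (1 - α) * II f α 2 0 0 t := by
  have H := MM_int hf hf0 hf1 hα hα1 ht hts hI
  have e := integral_eq_zero_of_hasDerivAt_of_integrable (f := MM f α 1 0 0 t)
    (f' := fun x => MM f α 0 1 0 t x + (α - 1) * MM f α 2 0 0 t x)
    (fun x => by
      have := (w_x (α := α) hf hf0 hf1 ht x).mul (bar_x hf hf0 hf1 ht 1 (by norm_num) x)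
      have e : MM f α 1 0 0 t = fun x => PP f 0 t x ^ α * (PP f 1 t x / PP f 0 t x) := by
        ext x; simp only [MM]; ring
      rw [e]
      refine HasDerivAt.congr_deriv this ?_
      simp only [MM]; ring)
    ((H 0 1 0 (by norm_num)).add ((H 2 0 0 (by norm_num)).const_mul _)) (H 1 0 0 (by norm_num))
  rw [integral_add (H 0 1 0 (by norm_num)) ((H 2 0 0 (by norm_num)).const_mul _),
    integral_const_mul] at e
  simp only [II]
  linarith

lemma ibp2 (hf : Integrable f) (hf0 : ∀ x, 0 ≤ f x) (hf1 : (∫ x, f x) = 1)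
    (hα : 0 < α) (hα1 : α < 1) (ht : 0 < t) (hts : t < s)
    (hI : Integrable (fun x => PP f 0 s x ^ α)) :
    3 * II f α 2 1 0 t = (3 - α) * II f α 4 0 0 t := by
  have H := MM_int hf hf0 hf1 hα hα1 ht hts hI
  have e := integral_eq_zero_of_hasDerivAt_of_integrable (f := MM f α 3 0 0 t)
    (f' := fun x => 3 * MM f α 2 1 0 t x + (α - 3) * MM f α 4 0 0 t x)
    (fun x => by
      have := (w_x (α := α) hf hf0 hf1 ht x).mul ((bar_x hf hf0 hf1 ht 1 (by norm_num) x).pow 3)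
      have e : MM f α 3 0 0 t = fun x => PP f 0 t x ^ α * (PP f 1 t x / PP f 0 t x) ^ 3 := by
        ext x; simp only [MM]; ring
      rw [e]
      refine HasDerivAt.congr_deriv this ?_
      simp only [MM, Pi.pow_apply]; push_cast; ring)
    (((H 2 1 0 (by norm_num)).const_mul _).add ((H 4 0 0 (by norm_num)).const_mul _))
    (H 3 0 0 (by norm_num))
  rw [integral_add ((H 2 1 0 (by norm_num)).const_mul _) ((H 4 0 0 (by norm_num)).const_mul _),
    integral_const_mul, integral_const_mul] at e
  simp only [II]
  linarith

lemma ibp3 (hf : Integrable f) (hf0 : ∀ x, 0 ≤ f x) (hf1 : (∫ x, f x) = 1)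
    (hα : 0 < α) (hα1 : α < 1) (ht : 0 < t) (hts : t < s)
    (hI : Integrable (fun x => PP f 0 s x ^ α)) :
    II f α 1 0 1 t = (2 - α) * II f α 2 1 0 t - II f α 0 2 0 t := by
  have H := MM_int hf hf0 hf1 hα hα1 ht hts hI
  have e := integral_eq_zero_of_hasDerivAt_of_integrable (f := MM f α 1 1 0 t)
    (f' := fun x => (MM f α 1 0 1 t x + MM f α 0 2 0 t x) + (α - 2) * MM f α 2 1 0 t x)
    (fun x => by
      have := (w_x (α := α) hf hf0 hf1 ht x).mul ((bar_x hf hf0 hf1 ht 1 (by norm_num) x).mul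
        (bar_x hf hf0 hf1 ht 2 (by norm_num) x))
      have e : MM f α 1 1 0 t = fun x => PP f 0 t x ^ α * (PP f 1 t x / PP f 0 t x *
          (PP f 2 t x / PP f 0 t x)) := by
        ext x; simp only [MM]; ring
      rw [e]
      refine HasDerivAt.congr_deriv this ?_
      simp only [MM, Pi.mul_apply]; ring)
    (((H 1 0 1 (by norm_num)).add (H 0 2 0 (by norm_num))).add
      ((H 2 1 0 (by norm_num)).const_mul _)) (H 1 1 0 (by norm_num))
  have e3 := integral_add ((H 1 0 1 (by norm_num)).add (H 0 2 0 (by norm_num)))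
    ((H 2 1 0 (by norm_num)).const_mul (α - 2))
  simp only [Pi.add_apply] at e3
  rw [e3, integral_add (H 1 0 1 (by norm_num)) (H 0 2 0 (by norm_num)), integral_const_mul] at e
  simp only [II]
  linarith

lemma J_deriv (hf : Integrable f) (hf0 : ∀ x, 0 ≤ f x) (hf1 : (∫ x, f x) = 1)
    (hα : 0 < α) (hα1 : α < 1) (ht : 0 < t) (hts : t < s)
    (hI : Integrable (fun x => PP f 0 s x ^ α)) :
    HasDerivAt (II f α 0 0 0) (α * (1 - α) / 2 * II f α 2 0 0 t) t := by
  obtain ⟨C, hC, hb⟩ := MM_bound hf hf0 hf1 hα hα1 (t₁ := t / 2) (t₂ := (t + s) / 2) (s := s)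
    (by linarith) (by linarith) (by linarith)
  have H := MM_int hf hf0 hf1 hα hα1 ht hts hI
  have := (hasDerivAt_integral_of_dominated_loc_of_deriv_le (s := Set.Ioo (t / 2) ((t + s) / 2))
    (x₀ := t) (μ := volume) (F := fun t x => MM f α 0 0 0 t x)
    (bound := fun x => α / 2 * (C * PP f 0 s x ^ α)) (F' := fun t x => α / 2 * MM f α 0 1 0 t x)
    (Ioo_mem_nhds (by linarith) (by linarith))
    ((eventually_gt_nhds ht).mono fun r hr => (MM_meas hf hr α 0 0 0).aestronglyMeasurable)
    (H 0 0 0 (by norm_num)) ((H 0 1 0 (by norm_num)).const_mul _).aestronglyMeasurable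
    (Eventually.of_forall fun x r hr => ?_) ((hI.const_mul C).const_mul _)
    (Eventually.of_forall fun x r hr => ?_)).2
  · refine HasDerivAt.congr_deriv this ?_
    rw [integral_const_mul]
    have := ibp1 hf hf0 hf1 hα hα1 ht hts hI
    simp only [II] at this ⊢
    rw [this]; ring
  · rw [norm_mul, Real.norm_eq_abs, Real.norm_eq_abs, abs_of_pos (by positivity)]
    gcongr
    exact hb r hr.1.le hr.2.le x 0 1 0 (by norm_num)
  · have hr0 : 0 < r := by linarith [hr.1]
    have := w_t (α := α) hf hf0 hf1 hr0 x
    simp only [MM, pow_zero, mul_one, pow_one, one_mul]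
    refine this.congr_deriv ?_
    ring

lemma A_deriv (hf : Integrable f) (hf0 : ∀ x, 0 ≤ f x) (hf1 : (∫ x, f x) = 1)
    (hα : 0 < α) (hα1 : α < 1) (ht : 0 < t) (hts : t < s)
    (hI : Integrable (fun x => PP f 0 s x ^ α)) :
    HasDerivAt (II f α 2 0 0) ((1 - α / 2) * II f α 2 1 0 t - II f α 0 2 0 t) t := by
  obtain ⟨C, hC, hb⟩ := MM_bound hf hf0 hf1 hα hα1 (t₁ := t / 2) (t₂ := (t + s) / 2) (s := s)
    (by linarith) (by linarith) (by linarith)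
  have H := MM_int hf hf0 hf1 hα hα1 ht hts hI
  have := (hasDerivAt_integral_of_dominated_loc_of_deriv_le (s := Set.Ioo (t / 2) ((t + s) / 2))
    (x₀ := t) (μ := volume) (F := fun t x => MM f α 2 0 0 t x)
    (bound := fun x => |α / 2 - 1| * (C * PP f 0 s x ^ α) + C * PP f 0 s x ^ α)
    (F' := fun t x => (α / 2 - 1) * MM f α 2 1 0 t x + MM f α 1 0 1 t x)
    (Ioo_mem_nhds (by linarith) (by linarith))
    ((eventually_gt_nhds ht).mono fun r hr => (MM_meas hf hr α 2 0 0).aestronglyMeasurable)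
    (H 2 0 0 (by norm_num))
    (((H 2 1 0 (by norm_num)).const_mul _).add (H 1 0 1 (by norm_num))).aestronglyMeasurable
    (Eventually.of_forall fun x r hr => ?_)
    (((hI.const_mul C).const_mul _).add (hI.const_mul C))
    (Eventually.of_forall fun x r hr => ?_)).2
  · refine HasDerivAt.congr_deriv this ?_
    rw [integral_add ((H 2 1 0 (by norm_num)).const_mul _) (H 1 0 1 (by norm_num)),
      integral_const_mul]
    have := ibp3 hf hf0 hf1 hα hα1 ht hts hI
    simp only [II] at this ⊢
    rw [this]; ring
  · refine (norm_add_le _ _).trans ?_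
    rw [norm_mul, Real.norm_eq_abs, Real.norm_eq_abs, Real.norm_eq_abs]
    gcongr
    · exact hb r hr.1.le hr.2.le x 2 1 0 (by norm_num)
    · exact hb r hr.1.le hr.2.le x 1 0 1 (by norm_num)
  · have hr0 : 0 < r := by linarith [hr.1]
    have := (w_t (α := α) hf hf0 hf1 hr0 x).mul ((bar_t hf hf0 hf1 hr0 x).pow 2)
    simp only [MM, pow_zero, mul_one, pow_one, one_mul]
    refine HasDerivAt.congr_deriv this ?_
    simp only [Pi.pow_apply]; push_cast; ring

lemma J_pos (hf : Integrable f) (hf0 : ∀ x, 0 ≤ f x) (hf1 : (∫ x, f x) = 1)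
    (hα : 0 < α) (hα1 : α < 1) (ht : 0 < t) (hts : t < s)
    (hI : Integrable (fun x => PP f 0 s x ^ α)) : 0 < II f α 0 0 0 t := by
  have H := MM_int hf hf0 hf1 hα hα1 ht hts hI 0 0 0 (by norm_num)
  have hpos : ∀ x, 0 < MM f α 0 0 0 t x := fun x => by
    simpa [MM] using Real.rpow_pos_of_pos (PP_pos hf hf0 hf1 ht x) α
  unfold II
  rw [integral_pos_iff_support_of_nonneg (fun x => (hpos x).le) H]
  have : Function.support (fun x => MM f α 0 0 0 t x) = Set.univ := by
    ext x; simp [(hpos x).ne']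
  rw [this]; simp

lemma key_ineq (hf : Integrable f) (hf0 : ∀ x, 0 ≤ f x) (hf1 : (∫ x, f x) = 1)
    (hα : 0 < α) (hα1 : α < 1) (ht : 0 < t) (hts : t < s)
    (hI : Integrable (fun x => PP f 0 s x ^ α)) :
    α ^ 2 * II f α 2 0 0 t ^ 2 ≤
      II f α 0 0 0 t * (II f α 0 2 0 t - (1 - α / 2) * II f α 2 1 0 t) := by
  have H := MM_int hf hf0 hf1 hα hα1 ht hts hI
  have hJ := J_pos hf hf0 hf1 hα hα1 ht hts hI
  have i1 := ibp1 hf hf0 hf1 hα hα1 ht hts hI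
  have i2 := ibp2 hf hf0 hf1 hα hα1 ht hts hI
  have hw : ∀ x, 0 ≤ PP f 0 t x ^ α := fun x =>
    (Real.rpow_pos_of_pos (PP_pos hf hf0 hf1 ht x) α).le
  have h4 : 0 ≤ II f α 4 0 0 t := integral_nonneg fun x => by
    simp only [MM, pow_zero, mul_one]
    have := hw x
    exact mul_nonneg this (by positivity)
  -- the square
  have hsq : ∀ μ : ℝ, 0 ≤ II f α 0 2 0 t - 2 * II f α 2 1 0 t + II f α 4 0 0 t
      + μ ^ 2 * II f α 0 0 0 t + 2 * μ * II f α 0 1 0 t - 2 * μ * II f α 2 0 0 t := by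
    intro μ
    have h : 0 ≤ ∫ x, (MM f α 0 2 0 t x + (-2) * MM f α 2 1 0 t x + MM f α 4 0 0 t x
      + μ ^ 2 * MM f α 0 0 0 t x + 2 * μ * MM f α 0 1 0 t x + (-2 * μ) * MM f α 2 0 0 t x) := by
      refine integral_nonneg fun x => ?_
      have : (0:ℝ) ≤ PP f 0 t x ^ α * (PP f 2 t x / PP f 0 t x
        - (PP f 1 t x / PP f 0 t x) ^ 2 + μ) ^ 2 := mul_nonneg (hw x) (sq_nonneg _)
      refine this.trans (le_of_eq ?_)
      simp only [MM]; ring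
    have a1 := H 0 2 0 (by norm_num)
    have a2 := (H 2 1 0 (by norm_num)).const_mul (-2)
    have a3 := H 4 0 0 (by norm_num)
    have a4 := (H 0 0 0 (by norm_num)).const_mul (μ ^ 2)
    have a5 := (H 0 1 0 (by norm_num)).const_mul (2 * μ)
    have a6 := (H 2 0 0 (by norm_num)).const_mul (-2 * μ)
    have b1 := integral_add a1 a2
    have b2 := integral_add (a1.add a2) a3
    have b3 := integral_add ((a1.add a2).add a3) a4
    have b4 := integral_add (((a1.add a2).add a3).add a4) a5
    have b5 := integral_add ((((a1.add a2).add a3).add a4).add a5) a6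
    simp only [Pi.add_apply, integral_const_mul] at b1 b2 b3 b4 b5
    rw [b5, b4, b3, b2, b1] at h
    simp only [II]
    linarith
  have h := hsq (α * II f α 2 0 0 t / II f α 0 0 0 t)
  rw [i1] at h
  set J := II f α 0 0 0 t
  set A := II f α 2 0 0 t
  set B := II f α 0 2 0 t
  set A21 := II f α 2 1 0 t
  set A4 := II f α 4 0 0 t
  have h' := mul_nonneg hJ.le h
  have e : J * (B - 2 * A21 + A4 + (α * A / J) ^ 2 * J + 2 * (α * A / J) * ((1 - α) * A)
      - 2 * (α * A / J) * A) = J * (B - 2 * A21 + A4) - α ^ 2 * A ^ 2 := by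
    field_simp; ring
  rw [e] at h'
  have h5 : -2 * A21 + A4 ≤ -(1 - α / 2) * A21 := by
    have : A21 = (3 - α) / 3 * A4 := by linarith
    rw [this]
    nlinarith [mul_nonneg (mul_nonneg hα.le (sub_nonneg.2 hα1.le)) h4]
  nlinarith [mul_le_mul_of_nonneg_left h5 hJ.le]

end

end RenyiAux

open RenyiAux

/-- Concavity of the (α+1)/2 power of the Rényi entropy power, i.e. of
t ↦ exp((α+1)·h_α(p(·,t))), along the heat flow, for orders 0 < α < 1. -/
theorem renyi_entropy_power_concave
    (f : ℝ → ℝ) (hfm : Measurable f) (hf0 : ∀ x, 0 ≤ f x)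
    (hf1 : (∫ x : ℝ, f x) = 1)
    (α : ℝ) (hαl : 0 < α) (hαu : α < 1) :
    ConcaveOn ℝ {t : ℝ | 0 < t ∧ ltTalpha f α t}
      (fun t => Real.exp ((α + 1) * renyiEnt f α t))
    ∧ ∀ t : ℝ, 0 < t → ltTalpha f α t →
      iteratedDeriv 2 (fun s => Real.exp ((α + 1) * renyiEnt f α s)) t ≤ 0 := by
  have hf : Integrable f := by
    by_contra h
    rw [integral_undef h] at hf1
    exact zero_ne_one hf1
  set D : Set ℝ := {t : ℝ | 0 < t ∧ ltTalpha f α t} with hDdef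
  have hD : ∀ t ∈ D, 0 < t ∧ ∃ s, t < s ∧ Integrable (fun x => PP f 0 s x ^ α) := by
    rintro t ⟨ht, s, hts, hs, hfin⟩
    refine ⟨ht, s, hts, ?_⟩
    rw [renyiFinite, if_neg hαu.ne] at hfin
    simpa only [heatP_eq] using hfin.1
  have hDo : IsOpen D := by
    rw [isOpen_iff_mem_nhds]
    rintro t ⟨ht, s, hts, hs, hfin⟩
    filter_upwards [Ioo_mem_nhds ht hts] with r hr
    exact ⟨hr.1, s, hr.2, hs, hfin⟩
  have hDc : Convex ℝ D := by
    rw [convex_iff_ordConnected]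
    refine ⟨?_⟩
    rintro a ⟨ha, -⟩ b ⟨-, s, hbs, hs, hfin⟩ r hr
    exact ⟨lt_of_lt_of_le ha hr.1, s, lt_of_le_of_lt hr.2 hbs, hs, hfin⟩
  obtain ⟨κ, hκ⟩ : ∃ κ, κ = (α + 1) * (1 - α)⁻¹ := ⟨_, rfl⟩
  have h1α : 0 < 1 - α := by linarith
  have hκ0 : 0 < κ := by rw [hκ]; positivity
  have hF : (fun t => Real.exp ((α + 1) * renyiEnt f α t))
      = fun t => Real.exp (κ * Real.log (II f α 0 0 0 t)) := by
    ext t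
    rw [renyiEnt, if_neg hαu.ne, hκ, mul_assoc]
    simp [II, MM, heatP_eq]
  rw [hF]
  have hd1 : ∀ t ∈ D, HasDerivAt (fun t => Real.exp (κ * Real.log (II f α 0 0 0 t)))
      (Real.exp (κ * Real.log (II f α 0 0 0 t)) *
        (κ * (α * (1 - α) / 2 * II f α 2 0 0 t / II f α 0 0 0 t))) t := by
    intro t ht
    obtain ⟨ht0, s, hts, hI⟩ := hD t ht
    have hJ := J_pos hf hf0 hf1 hαl hαu ht0 hts hI
    exact (((J_deriv hf hf0 hf1 hαl hαu ht0 hts hI).log hJ.ne').const_mul κ).exp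
  have hd2 : ∀ t ∈ D, HasDerivAt (fun t => Real.exp (κ * Real.log (II f α 0 0 0 t)) *
        (κ * (α * (1 - α) / 2 * II f α 2 0 0 t / II f α 0 0 0 t)))
      (Real.exp (κ * Real.log (II f α 0 0 0 t)) * (κ * (α * (1 - α) / 2)) / II f α 0 0 0 t ^ 2 *
        (α ^ 2 * II f α 2 0 0 t ^ 2 - II f α 0 0 0 t *
          (II f α 0 2 0 t - (1 - α / 2) * II f α 2 1 0 t))) t := by
    intro t ht
    obtain ⟨ht0, s, hts, hI⟩ := hD t ht
    have hJ := J_pos hf hf0 hf1 hαl hαu ht0 hts hI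
    have hA := A_deriv hf hf0 hf1 hαl hαu ht0 hts hI
    have hJd := J_deriv hf hf0 hf1 hαl hαu ht0 hts hI
    refine HasDerivAt.congr_deriv
      ((hd1 t ht).mul (((hA.const_mul (α * (1 - α) / 2)).div hJd hJ.ne').const_mul κ)) ?_
    have hk2 : κ * (1 - α) = α + 1 := by rw [hκ]; field_simp
    have hk3 : κ = (α + 1) / (1 - α) := by rw [hκ]; field_simp
    rw [hk3]
    field_simp
    ring
  have hneg : ∀ t ∈ D,
      Real.exp (κ * Real.log (II f α 0 0 0 t)) * (κ * (α * (1 - α) / 2)) / II f α 0 0 0 t ^ 2 *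
        (α ^ 2 * II f α 2 0 0 t ^ 2 - II f α 0 0 0 t *
          (II f α 0 2 0 t - (1 - α / 2) * II f α 2 1 0 t)) ≤ 0 := by
    intro t ht
    obtain ⟨ht0, s, hts, hI⟩ := hD t ht
    have hkey := key_ineq hf hf0 hf1 hαl hαu ht0 hts hI
    refine mul_nonpos_of_nonneg_of_nonpos (by positivity) (by linarith)
  constructor
  · have hDi : ∀ t ∈ interior D, t ∈ D := fun t ht => interior_subset ht
    exact concaveOn_of_hasDerivWithinAt2_nonpos hDc
      (fun t ht => (hd1 t ht).continuousAt.continuousWithinAt)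
      (fun t ht => (hd1 t (hDi t ht)).hasDerivWithinAt)
      (fun t ht => (hd2 t (hDi t ht)).hasDerivWithinAt)
      (fun t ht => hneg t (hDi t ht))
  · intro t ht0 htl
    have ht : t ∈ D := ⟨ht0, htl⟩
    rw [iteratedDeriv_succ, iteratedDeriv_one]
    have : deriv (fun t => Real.exp (κ * Real.log (II f α 0 0 0 t))) =ᶠ[nhds t]
        fun t => Real.exp (κ * Real.log (II f α 0 0 0 t)) *
        (κ * (α * (1 - α) / 2 * II f α 2 0 0 t / II f α 0 0 0 t)) := by
      filter_upwards [hDo.mem_nhds ht] with r hr using (hd1 r hr).deriv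
    rw [this.deriv_eq, (hd2 t ht).deriv]
    exact hneg t ht
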